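/- For all positive integers m and all p, q ∈ [0,1] with p ∈ (0,1), ℓ1(Bin(m,p), Bin(m,q)) ≤ 2 · min( m|p−q|, √m |p−q| / √(p(1−p)), 1 ). -/

import Mathlib

/-- The probability mass function of the binomial distribution `Bin(m,p)` at `j`. -/
noncomputable def binomPMF (m : ℕ) (p : ℝ) (j : ℕ) : ℝ :=
  (m.choose j : ℝ) * p ^ j * (1 - p) ^ (m - j)

/-- The ℓ1 distance between the binomial distributions `Bin(m,p)` and `Bin(m,q)`. -/
noncomputable def binomL1 (m : ℕ) (p q : ℝ) : ℝ :=
  ∑ j ∈ Finset.range (m + 1), |binomPMF m p j - binomPMF m q j|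

theorem binomPMF_nonneg (m j : ℕ) {p : ℝ} (hp0 : 0 ≤ p) (hp1 : p ≤ 1) : 0 ≤ binomPMF m p j := by
  have : 0 ≤ 1 - p := by linarith
  unfold binomPMF
  positivity

theorem binomPMF_pos {m j : ℕ} (hj : j ≤ m) {p : ℝ} (hp0 : 0 < p) (hp1 : p < 1) :
    0 < binomPMF m p j := by
  have h1 : 0 < 1 - p := by linarith
  have h2 : 0 < m.choose j := Nat.choose_pos hj
  unfold binomPMF
  positivity

theorem sum_binomPMF (m : ℕ) (p : ℝ) : ∑ j ∈ Finset.range (m + 1), binomPMF m p j = 1 := by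
  have h := add_pow p (1 - p) m
  rw [add_sub_cancel, one_pow] at h
  rw [h]
  exact Finset.sum_congr rfl fun j _ => by unfold binomPMF; ring

theorem binomPMF_eq_zero_of_lt {m j : ℕ} (hj : m < j) (p : ℝ) : binomPMF m p j = 0 := by
  simp [binomPMF, Nat.choose_eq_zero_of_lt hj]

theorem binomPMF_succ_zero (m : ℕ) (p : ℝ) :
    binomPMF (m + 1) p 0 = (1 - p) * binomPMF m p 0 := by
  simp [binomPMF, pow_succ']

theorem binomPMF_succ_succ (m j : ℕ) (p : ℝ) :
    binomPMF (m + 1) p (j + 1) = p * binomPMF m p j + (1 - p) * binomPMF m p (j + 1) := by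
  unfold binomPMF
  rw [Nat.choose_succ_succ, Nat.add_sub_add_right]
  rcases lt_or_ge j m with hj | hj
  · obtain ⟨k, rfl⟩ := Nat.exists_eq_add_of_lt hj
    rw [show j + k + 1 - j = k + 1 by omega, show j + k + 1 - (j + 1) = k by omega]
    push_cast
    ring
  · rw [Nat.choose_eq_zero_of_lt (show m < j + 1 by omega)]
    push_cast
    ring

theorem sum_range_succ_add_zero_eq {g : ℕ → ℝ} {n : ℕ} (hg : g n = 0) :
    ∑ j ∈ Finset.range n, g (j + 1) + g 0 = ∑ j ∈ Finset.range n, g j := by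
  rw [← Finset.sum_range_succ' g, Finset.sum_range_succ, hg, add_zero]

theorem binomL1_succ_le (m : ℕ) {p q : ℝ} (hp0 : 0 ≤ p) (hp1 : p ≤ 1) (hq0 : 0 ≤ q)
    (hq1 : q ≤ 1) : binomL1 (m + 1) p q ≤ binomL1 m p q + 2 * |p - q| := by
  have hp1' : 0 ≤ 1 - p := by linarith
  set d : ℕ → ℝ := fun j => |binomPMF m p j - binomPMF m q j| with hd
  set b : ℕ → ℝ := binomPMF m q with hb
  have hb0 : ∀ j, 0 ≤ b j := fun j => binomPMF_nonneg m j hq0 hq1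
  have hsucc : ∀ j, |binomPMF (m + 1) p (j + 1) - binomPMF (m + 1) q (j + 1)| ≤
      p * d j + (1 - p) * d (j + 1) + |p - q| * (b j + b (j + 1)) := by
    intro j
    rw [binomPMF_succ_succ, binomPMF_succ_succ]
    calc _ = |p * (binomPMF m p j - b j) + (1 - p) * (binomPMF m p (j + 1) - b (j + 1))
            + (p - q) * (b j - b (j + 1))| := by rw [hb]; congr 1; ring
      _ ≤ _ := (abs_add_three _ _ _)
      _ ≤ _ := by
        rw [abs_mul, abs_mul, abs_mul, abs_of_nonneg hp0, abs_of_nonneg hp1']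
        gcongr
        exact abs_le.2 ⟨by linarith [hb0 j, hb0 (j + 1)], by linarith [hb0 j, hb0 (j + 1)]⟩
  have hzero : |binomPMF (m + 1) p 0 - binomPMF (m + 1) q 0| ≤
      (1 - p) * d 0 + |p - q| * b 0 := by
    rw [binomPMF_succ_zero, binomPMF_succ_zero]
    calc _ = |(1 - p) * (binomPMF m p 0 - b 0) + (q - p) * b 0| := by rw [hb]; congr 1; ring
      _ ≤ _ := (abs_add_le _ _)
      _ = _ := by rw [abs_mul, abs_mul, abs_of_nonneg hp1', abs_of_nonneg (hb0 0), abs_sub_comm q p]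
  have hdsum := sum_range_succ_add_zero_eq (g := d) (n := m + 1)
    (by simp [hd, hb, binomPMF_eq_zero_of_lt (Nat.lt_succ_self m)])
  have hbsum := sum_range_succ_add_zero_eq (g := b) (n := m + 1)
    (binomPMF_eq_zero_of_lt (Nat.lt_succ_self m) q)
  have hb1 : ∑ j ∈ Finset.range (m + 1), b j = 1 := sum_binomPMF m q
  have hL : binomL1 m p q = ∑ j ∈ Finset.range (m + 1), d j := rfl
  have hS := Finset.sum_le_sum fun j (_ : j ∈ Finset.range (m + 1)) => hsucc j
  simp only [Finset.sum_add_distrib, ← Finset.mul_sum] at hS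
  rw [hb1] at hS hbsum
  have hd' := eq_sub_of_add_eq hdsum
  have hb' := eq_sub_of_add_eq hbsum
  rw [hd', hb'] at hS
  rw [hL, binomL1, Finset.sum_range_succ']
  linarith

theorem binomL1_le_mul_abs_sub (m : ℕ) {p q : ℝ} (hp0 : 0 ≤ p) (hp1 : p ≤ 1) (hq0 : 0 ≤ q)
    (hq1 : q ≤ 1) : binomL1 m p q ≤ 2 * (m * |p - q|) := by
  induction m with
  | zero => simp [binomL1, binomPMF]
  | succ m ih =>
    have := binomL1_succ_le m hp0 hp1 hq0 hq1
    push_cast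
    linarith

theorem binomL1_le_two (m : ℕ) {p q : ℝ} (hp0 : 0 ≤ p) (hp1 : p ≤ 1) (hq0 : 0 ≤ q)
    (hq1 : q ≤ 1) : binomL1 m p q ≤ 2 := by
  calc binomL1 m p q ≤ ∑ j ∈ Finset.range (m + 1), (binomPMF m p j + binomPMF m q j) :=
        Finset.sum_le_sum fun j _ => abs_le.2
          ⟨by linarith [binomPMF_nonneg m j hp0 hp1, binomPMF_nonneg m j hq0 hq1],
            by linarith [binomPMF_nonneg m j hp0 hp1, binomPMF_nonneg m j hq0 hq1]⟩
    _ = 2 := by rw [Finset.sum_add_distrib, sum_binomPMF, sum_binomPMF]; norm_num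

theorem sum_binomPMF_sq_div (m : ℕ) {p : ℝ} (q : ℝ) (hp0 : 0 < p) (hp1 : p < 1) :
    ∑ j ∈ Finset.range (m + 1), binomPMF m q j ^ 2 / binomPMF m p j =
      (1 + (p - q) ^ 2 / (p * (1 - p))) ^ m := by
  have h1 : 1 - p ≠ 0 := by linarith
  have hbase : 1 + (p - q) ^ 2 / (p * (1 - p)) = q ^ 2 / p + (1 - q) ^ 2 / (1 - p) := by
    field_simp
    ring
  rw [hbase, add_pow]
  refine Finset.sum_congr rfl fun j hj => ?_
  have hc : (m.choose j : ℝ) ≠ 0 := by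
    exact_mod_cast (Nat.choose_pos (Finset.mem_range_succ_iff.1 hj)).ne'
  unfold binomPMF
  rw [div_pow, div_pow, ← pow_mul, ← pow_mul, mul_comm 2 j, mul_comm 2 (m - j), pow_mul, pow_mul]
  field_simp

/-- The ℓ1 distance is at most the square root of the χ² divergence. -/
theorem binomL1_sq_le (m : ℕ) {p : ℝ} (q : ℝ) (hp0 : 0 < p) (hp1 : p < 1) :
    binomL1 m p q ^ 2 ≤ (1 + (p - q) ^ 2 / (p * (1 - p))) ^ m - 1 := by
  have hpos : ∀ j ∈ Finset.range (m + 1), 0 < binomPMF m p j := fun j hj =>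
    binomPMF_pos (Finset.mem_range_succ_iff.1 hj) hp0 hp1
  have h := Finset.sq_sum_div_le_sum_sq_div (Finset.range (m + 1))
    (fun j => |binomPMF m p j - binomPMF m q j|) hpos
  rw [sum_binomPMF, div_one] at h
  refine h.trans_eq ?_
  calc _ = ∑ j ∈ Finset.range (m + 1),
        (binomPMF m q j ^ 2 / binomPMF m p j + binomPMF m p j - 2 * binomPMF m q j) :=
        Finset.sum_congr rfl fun j hj => by
          have := (hpos j hj).ne'
          rw [sq_abs]
          field_simp
          ring
    _ = _ := by
      rw [Finset.sum_sub_distrib, Finset.sum_add_distrib, ← Finset.mul_sum, sum_binomPMF,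
        sum_binomPMF, sum_binomPMF_sq_div m q hp0 hp1]
      ring

theorem binomL1_le_sqrt (m : ℕ) {p q : ℝ} (hp0 : 0 < p) (hp1 : p < 1) (hq0 : 0 ≤ q)
    (hq1 : q ≤ 1) :
    binomL1 m p q ≤ 2 * (Real.sqrt m * |p - q| / Real.sqrt (p * (1 - p))) := by
  have hv : 0 < p * (1 - p) := mul_pos hp0 (by linarith)
  set x : ℝ := Real.sqrt m * |p - q| / Real.sqrt (p * (1 - p)) with hx
  have hx0 : 0 ≤ x := by positivity
  have hx2 : x ^ 2 = m * ((p - q) ^ 2 / (p * (1 - p))) := by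
    rw [hx, div_pow, mul_pow, Real.sq_sqrt (Nat.cast_nonneg m), Real.sq_sqrt hv.le, sq_abs,
      mul_div_assoc]
  rcases le_total 1 x with h1 | h1
  · linarith [binomL1_le_two m hp0.le hp1.le hq0 hq1]
  · refine le_of_sq_le_sq ?_ (by positivity)
    have hexp : (1 + (p - q) ^ 2 / (p * (1 - p))) ^ m ≤ Real.exp (x ^ 2) := by
      rw [hx2, Real.exp_nat_mul]
      gcongr
      rw [add_comm]
      exact Real.add_one_le_exp _
    have hx1 : |x ^ 2| ≤ 1 := by
      rw [abs_of_nonneg (sq_nonneg x)]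
      exact pow_le_one₀ hx0 h1
    have h3 := (le_abs_self _).trans (Real.abs_exp_sub_one_le hx1)
    rw [abs_of_nonneg (sq_nonneg x)] at h3
    nlinarith [binomL1_sq_le m q hp0 hp1, sq_nonneg x]

/-- upper bound on the ℓ1 distance between binomial distributions. -/
theorem stmt6 (m : ℕ) (hm : 1 ≤ m) (p q : ℝ) (hp0 : 0 < p) (hp1 : p < 1)
    (hq0 : 0 ≤ q) (hq1 : q ≤ 1) :
    binomL1 m p q ≤ 2 * min ((m : ℝ) * |p - q|)
        (min (Real.sqrt m * |p - q| / Real.sqrt (p * (1 - p))) 1) := by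
  rw [mul_min_of_nonneg _ _ zero_le_two, mul_min_of_nonneg _ _ zero_le_two, mul_one]
  exact le_min (binomL1_le_mul_abs_sub m hp0.le hp1.le hq0 hq1)
    (le_min (binomL1_le_sqrt m hp0 hp1 hq0 hq1) (binomL1_le_two m hp0.le hp1.le hq0 hq1))
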